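/- Let G(y) = W_L σ_{L−1}(W_{L−1} σ_{L−2}(··· σ_1(W_1 y)···)) be an L-layer network where each σ_l is 1-Lipschitz, positive homogeneous, and applied elementwise, with ‖W_l‖_F ≤ M_l for all l, and inputs satisfying ‖y‖₂ ≤ c₇. Then for i.i.d. Rademacher variables ξ_1,...,ξ_B and any y_1,...,y_B: E_ξ[ sup_{G∈𝒢} (1/B)‖∑_{i=1}^B ξ_i G(y_i)‖₂ ] ≤ c₇(√(2 log(2) L) + 1)(∏_{l=1}^L M_l)/√B. -/

import Mathlib

/-- Frobenius norm of a matrix. -/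
noncomputable def frob {D d : ℕ} (W : Matrix (Fin D) (Fin d) ℝ) : ℝ :=
  Real.sqrt (∑ i, ∑ j, (W i j) ^ 2)

/-- Hidden representations of a feed-forward network: `netHidden n sig W l y` applies the first
`l` layers (each linear map followed by its elementwise activation) to the input `y`. -/
noncomputable def netHidden (n : ℕ → ℕ) (sig : ℕ → ℝ → ℝ)
    (W : ∀ l, Matrix (Fin (n (l + 1))) (Fin (n l)) ℝ) :
    ∀ l, (Fin (n 0) → ℝ) → Fin (n l) → ℝ
  | 0, y => y
  | l + 1, y => fun j => sig l ((W l).mulVec (netHidden n sig W l y) j)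

/-- The sign attached to a Boolean. -/
def rsgn (b : Bool) : ℝ := if b then (1:ℝ) else -1

theorem rsgn_true : rsgn true = 1 := by simp [rsgn]
theorem rsgn_false : rsgn false = -1 := by simp [rsgn]
theorem rsgn_not (b : Bool) : rsgn (!b) = - rsgn b := by cases b <;> simp [rsgn]

theorem sum_signs_succ {B : ℕ} (f : (Fin (B+1) → Bool) → ℝ) :
    ∑ σ, f σ = ∑ τ : Fin B → Bool,
      (f (Fin.cons true τ : Fin (B+1) → Bool) + f (Fin.cons false τ : Fin (B+1) → Bool)) := by
  rw [← Equiv.sum_comp (Fin.consEquiv (fun _ : Fin (B+1) => Bool)) f, Fintype.sum_prod_type,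
    Fintype.sum_bool, ← Finset.sum_add_distrib]
  rfl

theorem sum_signs_not {B : ℕ} (f : (Fin B → Bool) → ℝ) :
    ∑ σ, f σ = ∑ σ : Fin B → Bool, f (fun i => !σ i) := by
  have hinv : Function.Involutive (fun (σ : Fin B → Bool) => (fun i => !σ i)) := by
    intro σ; funext i; simp
  exact (Equiv.sum_comp hinv.toPerm f).symm

/-! ### Contraction -/

theorem exp_incr {x y d e : ℝ} (hxy : x ≤ y) (hd : 0 ≤ d) (hde : d ≤ e) :
    Real.exp (x + d) - Real.exp x ≤ Real.exp (y + e) - Real.exp y := by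
  rw [Real.exp_add, Real.exp_add]
  have h1 : Real.exp x ≤ Real.exp y := Real.exp_le_exp.2 hxy
  have h2 : Real.exp d ≤ Real.exp e := Real.exp_le_exp.2 hde
  have h3 : 1 ≤ Real.exp d := Real.one_le_exp hd
  have h4 := Real.exp_pos x
  nlinarith [mul_le_mul h1 (sub_le_sub_right h2 1) (by linarith) (by linarith)]

theorem exp_pair_diag {A t p : ℝ} (hp : |p| ≤ |t|) :
    Real.exp (A + p) + Real.exp (A - p) ≤ Real.exp (A + t) + Real.exp (A - t) := by
  have h := Real.cosh_le_cosh.2 hp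
  rw [Real.cosh_eq, Real.cosh_eq] at h
  simp only [sub_eq_add_neg, Real.exp_add]
  nlinarith [Real.exp_pos A]

theorem exp_pair {A B t s p q : ℝ} (hp : |p| ≤ |t|) (hq : |q| ≤ |s|) (hpq : |p - q| ≤ |t - s|) :
    Real.exp (A + p) + Real.exp (B - q) ≤ Real.exp (A + t) + Real.exp (A - t) ∨
    Real.exp (A + p) + Real.exp (B - q) ≤ Real.exp (B + s) + Real.exp (B - s) ∨
    Real.exp (A + p) + Real.exp (B - q) ≤ Real.exp (A + t) + Real.exp (B - s) ∨
    Real.exp (A + p) + Real.exp (B - q) ≤ Real.exp (B + s) + Real.exp (A - t) := by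
  rcases lt_or_ge (A + p) (B + q) with h1 | h1
  · right; left
    have := exp_pair_diag (A := B) hq
    have := Real.exp_le_exp.2 h1.le
    linarith
  rcases lt_or_ge (B - q) (A - p) with h2 | h2
  · left
    have := exp_pair_diag (A := A) hp
    have := Real.exp_le_exp.2 h2.le
    linarith
  right; right
  have hp' := abs_le.1 hp
  have hq' := abs_le.1 hq
  have hpq' := abs_le.1 hpq
  have move1 : ∀ t s : ℝ, s - q ≥ 0 → s - q ≤ t - p → B - s ≤ A + p →
      Real.exp (A + p) + Real.exp (B - q) ≤ Real.exp (A + t) + Real.exp (B - s) := by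
    intro t s a b c
    have := exp_incr c a b
    rw [show B - s + (s - q) = B - q by ring, show A + p + (t - p) = A + t by ring] at this
    linarith
  have move2 : ∀ t s : ℝ, p + t ≥ 0 → p + t ≤ q + s → A - t ≤ B - q →
      Real.exp (A + p) + Real.exp (B - q) ≤ Real.exp (B + s) + Real.exp (A - t) := by
    intro t s a b c
    have := exp_incr c a b
    rw [show A - t + (p + t) = A + p by ring, show B - q + (q + s) = B + s by ring] at this
    linarith
  rcases le_total 0 t with ht | ht <;> rcases le_total 0 s with hs | hs
  · rw [abs_of_nonneg ht] at hp'
    rw [abs_of_nonneg hs] at hq'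
    rcases le_total s t with hst | hst
    · rw [abs_of_nonneg (by linarith : 0 ≤ t - s)] at hpq'
      left; apply move1 t s <;> linarith
    · rw [abs_of_nonpos (by linarith : t - s ≤ 0)] at hpq'
      right; apply move2 t s <;> linarith
  · rw [abs_of_nonneg ht] at hp'
    rw [abs_of_nonpos hs] at hq'
    left
    have := Real.exp_le_exp.2 (by linarith : A + p ≤ A + t)
    have := Real.exp_le_exp.2 (by linarith : B - q ≤ B - s)
    linarith
  · rw [abs_of_nonpos ht] at hp'
    rw [abs_of_nonneg hs] at hq'
    right
    have := Real.exp_le_exp.2 (by linarith : A + p ≤ A - t)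
    have := Real.exp_le_exp.2 (by linarith : B - q ≤ B + s)
    linarith
  · rw [abs_of_nonpos ht] at hp'
    rw [abs_of_nonpos hs] at hq'
    rcases le_total s t with hst | hst
    · rw [abs_of_nonneg (by linarith : 0 ≤ t - s)] at hpq'
      left
      have := move2 (-t) (-s) (by linarith) (by linarith) (by linarith)
      rw [show A - -t = A + t by ring, show B + -s = B - s by ring] at this
      linarith
    · rw [abs_of_nonpos (by linarith : t - s ≤ 0)] at hpq'
      right
      have := move1 (-t) (-s) (by linarith) (by linarith) (by linarith)
      rw [show B - -s = B + s by ring, show A + -t = A - t by ring] at this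
      linarith

/-- Talagrand contraction for the exponential, in selection form. -/
theorem contraction {ι : Type} (φ : ℝ → ℝ) (hlip : LipschitzWith 1 φ) (h0 : φ 0 = 0) :
    ∀ (B : ℕ) (h : ι → ℝ) (a : ι → Fin B → ℝ) (s : (Fin B → Bool) → ι),
    ∃ s' : (Fin B → Bool) → ι,
      ∑ σ, Real.exp (h (s σ) + ∑ i, rsgn (σ i) * φ (a (s σ) i)) ≤
      ∑ σ, Real.exp (h (s' σ) + ∑ i, rsgn (σ i) * a (s' σ) i) := by
  have hd : ∀ x y, |φ x - φ y| ≤ |x - y| := by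
    intro x y
    have := hlip.dist_le_mul x y
    simpa [Real.dist_eq] using this
  have hz : ∀ x, |φ x| ≤ |x| := by
    intro x
    have := hd x 0
    simpa [h0] using this
  intro B
  induction B with
  | zero => intro h a s; exact ⟨s, by simp⟩
  | succ B ih =>
    intro h a s
    obtain ⟨s1, hs1⟩ := ih (fun k => h k + φ (a k 0)) (fun k i => a k i.succ)
      (fun τ => s (Fin.cons true τ))
    obtain ⟨s2, hs2⟩ := ih (fun k => h k - φ (a k 0)) (fun k i => a k i.succ)
      (fun τ => s (Fin.cons false τ))
    have key : ∀ τ : Fin B → Bool, ∃ k : ι × ι,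
        Real.exp (h (s1 τ) + φ (a (s1 τ) 0) + ∑ i, rsgn (τ i) * a (s1 τ) i.succ) +
        Real.exp (h (s2 τ) - φ (a (s2 τ) 0) + ∑ i, rsgn (τ i) * a (s2 τ) i.succ) ≤
        Real.exp (h k.1 + a k.1 0 + ∑ i, rsgn (τ i) * a k.1 i.succ) +
        Real.exp (h k.2 - a k.2 0 + ∑ i, rsgn (τ i) * a k.2 i.succ) := by
      intro τ
      have := exp_pair (A := h (s1 τ) + ∑ i, rsgn (τ i) * a (s1 τ) i.succ)
        (B := h (s2 τ) + ∑ i, rsgn (τ i) * a (s2 τ) i.succ)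
        (hz (a (s1 τ) 0)) (hz (a (s2 τ) 0)) (hd (a (s1 τ) 0) (a (s2 τ) 0))
      have e1 : ∀ x y z : ℝ, x + y + z = x + z + y := fun x y z => by ring
      have e2 : ∀ x y z : ℝ, x - y + z = x + z - y := fun x y z => by ring
      simp only [e1 _ (φ _), e2, e1 _ (a _ 0)]
      rcases this with h | h | h | h
      · exact ⟨(s1 τ, s1 τ), h⟩
      · exact ⟨(s2 τ, s2 τ), h⟩
      · exact ⟨(s1 τ, s2 τ), h⟩
      · exact ⟨(s2 τ, s1 τ), h⟩
    choose k hk using key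
    refine ⟨fun σ => if σ 0 then (k (fun i => σ i.succ)).1 else (k (fun i => σ i.succ)).2, ?_⟩
    rw [sum_signs_succ, sum_signs_succ]
    simp only [Fin.sum_univ_succ, Fin.cons_zero, Fin.cons_succ, rsgn_true, rsgn_false, if_true,
      one_mul, neg_mul, ← add_assoc, ← sub_eq_add_neg, Bool.false_eq_true, if_false]
    rw [Finset.sum_add_distrib]
    refine (add_le_add hs1 hs2).trans ?_
    rw [← Finset.sum_add_distrib]
    exact Finset.sum_le_sum fun τ _ => hk τ

/-! ### Base case: a Pinelis-type bound -/

theorem cosh_pair {E : Type*} [NormedAddCommGroup E] [InnerProductSpace ℝ E] (a x : E) :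
    Real.cosh ‖a + x‖ + Real.cosh ‖a - x‖ ≤ 2 * (Real.cosh ‖a‖ * Real.cosh ‖x‖) := by
  have h2 : 2 * (Real.cosh ‖a‖ * Real.cosh ‖x‖)
      = Real.cosh (‖a‖ + ‖x‖) + Real.cosh (‖a‖ - ‖x‖) := by
    rw [Real.cosh_add, Real.cosh_sub]; ring
  rw [h2]
  refine hasSum_le ?_ ((Real.hasSum_cosh _).add (Real.hasSum_cosh _))
    ((Real.hasSum_cosh _).add (Real.hasSum_cosh _))
  intro k
  rw [← add_div, ← add_div]
  apply div_le_div_of_nonneg_right _ (by positivity)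
  simp only [pow_mul]
  rw [@norm_add_sq_real, @norm_sub_sq_real]
  have hin := abs_le.1 (abs_real_inner_le_norm a x)
  generalize inner ℝ a x = u at *
  have hna := norm_nonneg a
  have hnx := norm_nonneg x
  set p := (‖a‖ + ‖x‖)^2 with hp
  set q := (‖a‖ - ‖x‖)^2 with hq
  have hp0 : 0 ≤ p := sq_nonneg _
  have hq0 : 0 ≤ q := sq_nonneg _
  rcases eq_or_lt_of_le (mul_nonneg hna hnx) with h0 | h0
  · have hu : u = 0 := by rw [← h0] at hin; linarith [hin.1, hin.2]
    have e1 : p = ‖a‖^2 + ‖x‖^2 := by rw [hp]; linarith [h0, add_sq ‖a‖ ‖x‖]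
    have e2 : q = ‖a‖^2 + ‖x‖^2 := by rw [hq]; linarith [h0, sub_sq ‖a‖ ‖x‖]
    rw [e1, e2, hu]; simp
  · set θ := (1 + u / (‖a‖ * ‖x‖)) / 2 with hθ
    have hr1 : u / (‖a‖ * ‖x‖) ≤ 1 := by rw [div_le_one h0]; exact hin.2
    have hr2 : -1 ≤ u / (‖a‖ * ‖x‖) := by rw [le_div_iff₀ h0]; linarith [hin.1]
    have hru : u / (‖a‖ * ‖x‖) * (‖a‖ * ‖x‖) = u := div_mul_cancel₀ _ h0.ne'
    have t0 : 0 ≤ θ := by rw [hθ]; linarith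
    have t1 : 0 ≤ 1 - θ := by rw [hθ]; linarith
    have c := (convexOn_pow (𝕜 := ℝ) k).2
    have c1 := c (Set.mem_Ici.2 hp0) (Set.mem_Ici.2 hq0) t0 t1 (by ring)
    have c2 := c (Set.mem_Ici.2 hp0) (Set.mem_Ici.2 hq0) t1 t0 (by ring)
    simp only [smul_eq_mul] at c1 c2
    have e1 : θ * p + (1 - θ) * q = ‖a‖^2 + 2 * u + ‖x‖^2 := by
      rw [hθ, hp, hq]; linear_combination 2 * hru
    have e2 : (1 - θ) * p + θ * q = ‖a‖^2 - 2 * u + ‖x‖^2 := by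
      rw [hθ, hp, hq]; linear_combination (-2) * hru
    rw [e1] at c1
    rw [e2] at c2
    linarith

theorem sum_cosh_le {E : Type*} [NormedAddCommGroup E] [InnerProductSpace ℝ E] :
    ∀ (B : ℕ) (a : E) (x : Fin B → E),
    ∑ σ : Fin B → Bool, Real.cosh ‖a + ∑ i, rsgn (σ i) • x i‖ ≤
      2 ^ B * (Real.cosh ‖a‖ * ∏ i, Real.cosh ‖x i‖) := by
  intro B
  induction B with
  | zero => intro a x; simp
  | succ B ih =>
    intro a x
    rw [sum_signs_succ]
    simp only [Fin.sum_univ_succ, Fin.cons_zero, Fin.cons_succ, rsgn_true, rsgn_false,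
      one_smul, neg_smul, ← add_assoc, ← sub_eq_add_neg]
    rw [Finset.sum_add_distrib, Fin.prod_univ_succ]
    have h1 := ih (a + x 0) (fun i => x i.succ)
    have h2 := ih (a - x 0) (fun i => x i.succ)
    have h3 := cosh_pair a (x 0)
    have hP : 0 ≤ (2:ℝ) ^ B * ∏ i : Fin B, Real.cosh ‖x i.succ‖ :=
      mul_nonneg (by positivity) (Finset.prod_nonneg fun i _ => (Real.cosh_pos _).le)
    rw [pow_succ]
    nlinarith [mul_le_mul_of_nonneg_left h3 hP]

theorem sum_exp_norm_le {E : Type*} [NormedAddCommGroup E] [InnerProductSpace ℝ E]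
    (B : ℕ) (x : Fin B → E) (K c : ℝ) (hK : 0 ≤ K) (hc : ∀ i, ‖x i‖ ≤ c) :
    ∑ σ : Fin B → Bool, Real.exp (K * ‖∑ i, rsgn (σ i) • x i‖) ≤
      2 ^ B * 2 * Real.exp (K ^ 2 * (B * c ^ 2) / 2) := by
  have h := sum_cosh_le B (0 : E) (fun i => K • x i)
  have h1 : ∏ i, Real.cosh ‖K • x i‖ ≤ Real.exp (K ^ 2 * (B * c ^ 2) / 2) := by
    calc ∏ i, Real.cosh ‖K • x i‖ ≤ ∏ i : Fin B, Real.exp (K ^ 2 * c ^ 2 / 2) := by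
          apply Finset.prod_le_prod
          · intro i _; exact (Real.cosh_pos _).le
          · intro i _
            refine (Real.cosh_le_exp_half_sq _).trans (Real.exp_le_exp.2 ?_)
            rw [norm_smul, mul_pow, Real.norm_eq_abs, sq_abs]
            have := pow_le_pow_left₀ (norm_nonneg _) (hc i) 2
            nlinarith [sq_nonneg K]
      _ = _ := by
          rw [Finset.prod_const, ← Real.exp_nat_mul]
          congr 1
          simp; ring
  calc _ ≤ ∑ σ : Fin B → Bool, 2 * Real.cosh ‖(0:E) + ∑ i, rsgn (σ i) • K • x i‖ := by
        apply Finset.sum_le_sum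
        intro σ _
        have e : ‖(0:E) + ∑ i, rsgn (σ i) • K • x i‖ = K * ‖∑ i, rsgn (σ i) • x i‖ := by
          rw [zero_add, ← abs_of_nonneg hK, ← Real.norm_eq_abs, ← norm_smul, Finset.smul_sum]
          simp only [Real.norm_eq_abs, abs_of_nonneg hK, smul_comm K]
        rw [e, Real.cosh_eq]
        linarith [Real.exp_pos (-(K * ‖∑ i, rsgn (σ i) • x i‖))]
    _ ≤ _ := by
        rw [← Finset.mul_sum]
        simp only [norm_zero, Real.cosh_zero, one_mul] at h
        have : (2:ℝ)^B * ∏ i, Real.cosh ‖K • x i‖ ≤ 2 ^ B * Real.exp (K ^ 2 * (B * c ^ 2) / 2) :=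
          mul_le_mul_of_nonneg_left h1 (by positivity)
        linarith

/-! ### Peeling -/

/-- Euclidean norm. -/
noncomputable def enrm {d : ℕ} (v : Fin d → ℝ) : ℝ := Real.sqrt (∑ k, v k ^ 2)

/-- Signed sum of vectors. -/
noncomputable def ssum {B d : ℕ} (σ : Fin B → Bool) (h : Fin B → Fin d → ℝ) : Fin d → ℝ :=
  fun k => ∑ i, rsgn (σ i) * h i k

theorem enrm_nonneg {d : ℕ} (v : Fin d → ℝ) : 0 ≤ enrm v := Real.sqrt_nonneg _

theorem dot_ssum {B d : ℕ} (σ : Fin B → Bool) (h : Fin B → Fin d → ℝ) (w : Fin d → ℝ) :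
    ∑ i, rsgn (σ i) * (w ⬝ᵥ h i) = w ⬝ᵥ ssum σ h := by
  simp only [dotProduct, ssum, Finset.mul_sum]
  rw [Finset.sum_comm]
  refine Finset.sum_congr rfl fun i _ => Finset.sum_congr rfl fun j _ => by ring

theorem dot_le {d : ℕ} (w v : Fin d → ℝ) : w ⬝ᵥ v ≤ enrm w * enrm v :=
  Real.sum_mul_le_sqrt_mul_sqrt _ _ _

theorem enrm_rows {D d : ℕ} (W : Matrix (Fin D) (Fin d) ℝ) :
    ∑ k, enrm (W k) ^ 2 = frob W ^ 2 := by
  have h1 : frob W ^ 2 = ∑ i, ∑ j, W i j ^ 2 :=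
    Real.sq_sqrt (Finset.sum_nonneg fun i _ => Finset.sum_nonneg fun j _ => sq_nonneg _)
  rw [h1]
  exact Finset.sum_congr rfl fun i _ => Real.sq_sqrt (Finset.sum_nonneg fun j _ => sq_nonneg _)

theorem enrm_mulVec_le {D d : ℕ} (W : Matrix (Fin D) (Fin d) ℝ) (v : Fin d → ℝ) :
    enrm (W.mulVec v) ≤ frob W * enrm v := by
  have hf : 0 ≤ frob W := Real.sqrt_nonneg _
  apply Real.sqrt_le_iff.2 ⟨mul_nonneg hf (enrm_nonneg v), ?_⟩
  rw [mul_pow, ← enrm_rows, Finset.sum_mul]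
  refine Finset.sum_le_sum fun k _ => ?_
  rw [← mul_pow, ← sq_abs]
  refine pow_le_pow_left₀ (abs_nonneg _) (abs_le.2 ⟨?_, dot_le _ _⟩) 2
  have := dot_le (W k) (-v)
  have e : enrm (-v) = enrm v := by simp [enrm]
  rw [e, dotProduct_neg] at this
  have e2 : -(enrm (W k) * enrm v) ≤ W k ⬝ᵥ v := by linarith
  exact e2

theorem exists_row {B D d : ℕ} (φ : ℝ → ℝ) (hhom : ∀ a t : ℝ, 0 ≤ a → φ (a * t) = a * φ t)
    (σ : Fin B → Bool) (W : Matrix (Fin D) (Fin d) ℝ) (M : ℝ) (hW : frob W ≤ M)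
    (h : Fin B → Fin d → ℝ) :
    ∃ w : Fin d → ℝ, enrm w ≤ 1 ∧
      enrm (ssum σ (fun i j => φ (W.mulVec (h i) j))) ≤
        M * |∑ i, rsgn (σ i) * φ (w ⬝ᵥ h i)| := by
  have hf : 0 ≤ frob W := Real.sqrt_nonneg _
  have hM : 0 ≤ M := hf.trans hW
  set z : (Fin d → ℝ) → ℝ := fun w => ∑ i, rsgn (σ i) * φ (w ⬝ᵥ h i) with hz
  rcases isEmpty_or_nonempty (Fin D) with hD | hD
  · refine ⟨0, by simp [enrm], ?_⟩
    have : enrm (ssum σ (fun i j => φ (W.mulVec (h i) j))) = 0 := by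
      simp [enrm]
    rw [this]; positivity
  · let u : Fin D → Fin d → ℝ := fun k => (enrm (W k))⁻¹ • W k
    obtain ⟨k0, hk0⟩ := Finite.exists_max (fun k => |z (u k)|)
    have hsm : ∀ (c : ℝ) (v : Fin d → ℝ), 0 ≤ c → enrm (c • v) = c * enrm v := by
      intro c v hc
      unfold enrm
      simp only [Pi.smul_apply, smul_eq_mul, mul_pow, ← Finset.mul_sum]
      rw [Real.sqrt_mul (sq_nonneg c), Real.sqrt_sq hc]
    have hrow : ∀ k, enrm (W k) • u k = W k := by
      intro k
      rcases eq_or_ne (enrm (W k)) 0 with h0 | h0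
      · have hk : W k = 0 := by
          have h0' := (Real.sqrt_eq_zero (Finset.sum_nonneg fun j _ => sq_nonneg _)).1 h0
          rw [Finset.sum_eq_zero_iff_of_nonneg (fun j _ => sq_nonneg _)] at h0'
          funext j
          have := h0' j (Finset.mem_univ j)
          simpa using this
        simp [u, hk]
      · simp only [u, smul_smul, mul_inv_cancel₀ h0, one_smul]
    refine ⟨u k0, ?_, ?_⟩
    · simp only [u]
      rw [hsm _ _ (inv_nonneg.2 (enrm_nonneg _))]
      exact inv_mul_le_one
    · have hv : ∀ k, ssum σ (fun i j => φ (W.mulVec (h i) j)) k = enrm (W k) * z (u k) := by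
        intro k
        simp only [ssum, hz, Finset.mul_sum]
        refine Finset.sum_congr rfl fun i _ => ?_
        have : W.mulVec (h i) k = enrm (W k) * (u k ⬝ᵥ h i) := by
          rw [← smul_eq_mul, ← smul_dotProduct, hrow]; rfl
        rw [this, hhom _ _ (enrm_nonneg _)]; ring
      apply Real.sqrt_le_iff.2 ⟨by positivity, ?_⟩
      calc _ ≤ ∑ k, enrm (W k) ^ 2 * |z (u k0)| ^ 2 := by
            refine Finset.sum_le_sum fun k _ => ?_
            rw [hv, mul_pow, ← sq_abs (z (u k))]
            exact mul_le_mul_of_nonneg_left (pow_le_pow_left₀ (abs_nonneg _) (hk0 k) 2)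
              (sq_nonneg _)
        _ = frob W ^ 2 * |z (u k0)| ^ 2 := by rw [← Finset.sum_mul, enrm_rows]
        _ ≤ _ := by
            rw [mul_pow]
            exact mul_le_mul_of_nonneg_right (pow_le_pow_left₀ hf hW 2) (sq_nonneg _)

/-- Peeling off one layer, for an abstract family of feature maps. -/
theorem peel {ι : Type} {B D d : ℕ} (φ : ℝ → ℝ) (hlip : LipschitzWith 1 φ)
    (hhom : ∀ a t : ℝ, 0 ≤ a → φ (a * t) = a * φ t) (M K C : ℝ) (hM : 0 ≤ M) (hK : 0 ≤ K)
    (W : ι → Matrix (Fin D) (Fin d) ℝ) (hW : ∀ k, frob (W k) ≤ M)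
    (h : ι → Fin B → Fin d → ℝ)
    (hC : ∀ s : (Fin B → Bool) → ι, ∑ σ, Real.exp (K * M * enrm (ssum σ (h (s σ)))) ≤ C)
    (s : (Fin B → Bool) → ι) :
    ∑ σ, Real.exp (K * enrm (ssum σ (fun i j => φ ((W (s σ)).mulVec (h (s σ) i) j)))) ≤ 2 * C := by
  have hKM : 0 ≤ K * M := mul_nonneg hK hM
  choose w hw1 hw2 using fun σ => exists_row φ hhom σ (W (s σ)) M (hW _) (h (s σ))
  let κ : Type := ι × {w : Fin d → ℝ // enrm w ≤ 1}
  let a : κ → Fin B → ℝ := fun k i => K * M * (k.2.1 ⬝ᵥ h k.1 i)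
  have hφ0 : φ 0 = 0 := by simpa using hhom 0 0 le_rfl
  have hcon : ∀ r : (Fin B → Bool) → κ,
      ∑ σ, Real.exp (∑ i, rsgn (σ i) * φ (a (r σ) i)) ≤ C := by
    intro r
    obtain ⟨r', hr'⟩ := contraction φ hlip hφ0 B (fun _ : κ => 0) a r
    simp only [zero_add] at hr'
    refine hr'.trans (le_trans ?_ (hC (fun σ => (r' σ).1)))
    refine Finset.sum_le_sum fun σ _ => Real.exp_le_exp.2 ?_
    have : ∑ i, rsgn (σ i) * a (r' σ) i = K * M * ((r' σ).2.1 ⬝ᵥ ssum σ (h (r' σ).1)) := by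
      rw [← dot_ssum, Finset.mul_sum]
      refine Finset.sum_congr rfl fun i _ => by simp only [a]; ring
    rw [this]
    refine mul_le_mul_of_nonneg_left ((dot_le _ _).trans ?_) hKM
    exact mul_le_of_le_one_left (enrm_nonneg _) (r' σ).2.2
  let r : (Fin B → Bool) → κ := fun σ => (s σ, ⟨w σ, hw1 σ⟩)
  have h1 := hcon r
  have h2 := hcon (fun σ => r (fun i => !σ i))
  rw [sum_signs_not] at h2
  simp only [Bool.not_not, rsgn_not, neg_mul, Finset.sum_neg_distrib] at h2
  rw [two_mul]
  refine le_trans ?_ (add_le_add h1 h2)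
  rw [← Finset.sum_add_distrib]
  refine Finset.sum_le_sum fun σ _ => ?_
  have hz : ∑ i, rsgn (σ i) * φ (a (r σ) i)
      = K * M * ∑ i, rsgn (σ i) * φ (w σ ⬝ᵥ h (s σ) i) := by
    rw [Finset.mul_sum]
    refine Finset.sum_congr rfl fun i _ => ?_
    simp only [a, r]
    rw [hhom _ _ hKM]; ring
  rw [hz]
  have hle := mul_le_mul_of_nonneg_left (hw2 σ) hK
  rw [← mul_assoc] at hle
  refine (Real.exp_le_exp.2 hle).trans ?_
  rcases abs_cases (∑ i, rsgn (σ i) * φ (w σ ⬝ᵥ h (s σ) i)) with ⟨e, _⟩ | ⟨e, _⟩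
  · rw [e]; exact le_add_of_nonneg_right (Real.exp_pos _).le
  · rw [e, mul_neg]; exact le_add_of_nonneg_left (Real.exp_pos _).le

theorem hidden_bound (L B : ℕ) (n : ℕ → ℕ) (sig : ℕ → ℝ → ℝ)
    (hsig_lip : ∀ l, LipschitzWith 1 (sig l))
    (hsig_hom : ∀ l (a t : ℝ), 0 ≤ a → sig l (a * t) = a * sig l t)
    (M : ℕ → ℝ) (hM : ∀ l, 0 ≤ M l) (c7 : ℝ)
    (ys : Fin B → Fin (n 0) → ℝ)
    (hys : ∀ i, Real.sqrt (∑ j, (ys i j) ^ 2) ≤ c7) :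
    ∀ l ≤ L, ∀ K : ℝ, 0 ≤ K →
    ∀ s : (Fin B → Bool) → {W : ∀ l, Matrix (Fin (n (l + 1))) (Fin (n l)) ℝ //
        ∀ l < L, frob (W l) ≤ M l},
    ∑ σ, Real.exp (K * enrm (ssum σ (fun i => netHidden n sig (s σ).1 l (ys i)))) ≤
      2 ^ l * (2 ^ B * 2 *
        Real.exp ((K * ∏ l ∈ Finset.range l, M l) ^ 2 * (B * c7 ^ 2) / 2)) := by
  intro l
  induction l with
  | zero =>
    intro _ K hK s
    have := sum_exp_norm_le B (fun i => (WithLp.toLp 2 (ys i) : EuclideanSpace ℝ (Fin (n 0))))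
      K c7 hK (by
        intro i
        rw [EuclideanSpace.norm_eq]
        simpa using hys i)
    simp only [pow_zero, one_mul, Finset.range_zero, Finset.prod_empty, mul_one]
    refine le_trans (le_of_eq ?_) this
    refine Finset.sum_congr rfl fun σ _ => ?_
    rw [EuclideanSpace.norm_eq]
    simp [enrm, ssum, netHidden]
  | succ l ih =>
    intro hl K hK s
    have := peel (B := B) (sig l) (hsig_lip l) (hsig_hom l) (M l) K _ (hM l) hK
      (fun W : {W : ∀ l, Matrix (Fin (n (l + 1))) (Fin (n l)) ℝ //
        ∀ l < L, frob (W l) ≤ M l} => W.1 l) (fun W => W.2 l hl)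
      (fun W i => netHidden n sig W.1 l (ys i))
      (ih (Nat.le_of_succ_le hl) (K * M l) (mul_nonneg hK (hM l))) s
    refine this.trans (le_of_eq ?_)
    rw [Finset.prod_range_succ, pow_succ 2 l, mul_assoc K, mul_comm (M l)]
    ring

theorem sum_sSup_le {α : Type} [Fintype α] (S : α → Set ℝ) (hne : ∀ a, (S a).Nonempty)
    (C : ℝ) (hC : ∀ v : α → ℝ, (∀ a, v a ∈ S a) → ∑ a, v a ≤ C) : ∑ a, sSup (S a) ≤ C := by
  refine le_of_forall_pos_le_add fun ε hε => ?_
  have hN : (0:ℝ) < Fintype.card α + 1 := by positivity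
  have : ∀ a, ∃ v ∈ S a, sSup (S a) - ε / (Fintype.card α + 1) < v := fun a =>
    exists_lt_of_lt_csSup (hne a) (sub_lt_self _ (div_pos hε hN))
  choose v hv hlt using this
  have h1 := hC v hv
  have h2 : ∑ a, (sSup (S a) - ε / (Fintype.card α + 1)) ≤ ∑ a, v a :=
    Finset.sum_le_sum fun a _ => (hlt a).le
  rw [Finset.sum_sub_distrib, Finset.sum_const, nsmul_eq_mul, Finset.card_univ] at h2
  have h3 : (Fintype.card α : ℝ) * (ε / (Fintype.card α + 1)) ≤ ε := by
    rw [← mul_div_assoc, div_le_iff₀ hN]; nlinarith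
  linarith

/-- From exponential moments to the mean. -/
theorem mean_bound {B : ℕ} (L : ℕ) (hL : 0 < L) (Z : (Fin B → Bool) → ℝ) (Q : ℝ) (hQ : 0 ≤ Q)
    (hZ : ∀ K : ℝ, 0 ≤ K → ∑ σ, Real.exp (K * Z σ) ≤
      2 ^ B * 2 ^ L * Real.exp (K ^ 2 * Q ^ 2 / 2)) :
    ((2:ℝ) ^ B)⁻¹ * ∑ σ, Z σ ≤ Q * Real.sqrt (2 * Real.log 2 * L) := by
  set m := ((2:ℝ) ^ B)⁻¹ * ∑ σ, Z σ with hm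
  have hlog : 0 < Real.log 2 := Real.log_pos (by norm_num)
  have hLr : (0:ℝ) < L := by exact_mod_cast hL
  have hR : 0 < Real.sqrt (2 * Real.log 2 * L) := Real.sqrt_pos.2 (by positivity)
  have hRsq := Real.sq_sqrt (by positivity : 0 ≤ 2 * Real.log 2 * L)
  set R := Real.sqrt (2 * Real.log 2 * L) with hRdef
  have h2B : (0:ℝ) < 2 ^ B := by positivity
  have hmain : ∀ K : ℝ, 0 ≤ K → K * m ≤ R ^ 2 / 2 + K ^ 2 * Q ^ 2 / 2 := by
    intro K hK
    have hj := convexOn_exp.map_sum_le (t := Finset.univ) (w := fun _ : Fin B → Bool => ((2:ℝ)^B)⁻¹)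
      (p := fun σ => K * Z σ) (fun _ _ => by positivity) (by simp) (fun _ _ => Set.mem_univ _)
    simp only [smul_eq_mul, ← Finset.mul_sum] at hj
    have hj2 : Real.exp (K * m) ≤ Real.exp (L * Real.log 2 + K ^ 2 * Q ^ 2 / 2) := by
      calc Real.exp (K * m) = Real.exp (((2:ℝ)^B)⁻¹ * (K * ∑ σ, Z σ)) := by
            congr 1; rw [hm]; ring
        _ ≤ _ := hj
        _ ≤ ((2:ℝ)^B)⁻¹ * (2 ^ B * 2 ^ L * Real.exp (K ^ 2 * Q ^ 2 / 2)) :=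
            mul_le_mul_of_nonneg_left (hZ K hK) (by positivity)
        _ = _ := by
            rw [Real.exp_add, Real.exp_nat_mul, Real.exp_log (by norm_num)]
            field_simp
    have := Real.exp_le_exp.1 hj2
    rw [hRsq]; linarith
  have hall : ∀ Q' : ℝ, Q < Q' → m / R ≤ Q' := by
    intro Q' hQ'
    have hpos : 0 < Q' := lt_of_le_of_lt hQ hQ'
    have h1 := hmain (R / Q') (by positivity)
    have h2 : Q ^ 2 ≤ Q' ^ 2 := pow_le_pow_left₀ hQ hQ'.le 2
    have h3 : (R / Q') ^ 2 * Q ^ 2 ≤ R ^ 2 := by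
      calc _ ≤ (R / Q') ^ 2 * Q' ^ 2 := mul_le_mul_of_nonneg_left h2 (sq_nonneg _)
        _ = R ^ 2 := by field_simp
    have h4 : R / Q' * m ≤ R ^ 2 := by linarith
    rw [div_le_iff₀ hR]
    rw [div_mul_eq_mul_div, div_le_iff₀ hpos] at h4
    have : R * m ≤ R * (Q' * R) := by nlinarith
    exact le_of_mul_le_mul_left this hR
  have := le_of_forall_gt_imp_ge_of_dense hall
  rwa [div_le_iff₀ hR] at this


/-- Size-independent Rademacher bound (Golowich–Rakhlin–Shamir, vector-output version):
for the class of `L`-layer networks `G = W_L ∘ σ_{L−1} ∘ ⋯ ∘ σ_1 ∘ W_1` with 1-Lipschitz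
positive-homogeneous elementwise activations and `‖W_l‖_F ≤ M_l`, and inputs with
`‖yᵢ‖₂ ≤ c₇`,
`E_ξ[sup_G (1/B)‖∑ᵢ ξᵢ G(yᵢ)‖₂] ≤ c₇(√(2 log 2 · L) + 1)(∏ M_l)/√B`. -/
theorem stmt13 (L B : ℕ) (hL : 0 < L) (hB : 0 < B)
    (n : ℕ → ℕ) (sig : ℕ → ℝ → ℝ)
    (hsig_lip : ∀ l, LipschitzWith 1 (sig l))
    (hsig_hom : ∀ l (a t : ℝ), 0 ≤ a → sig l (a * t) = a * sig l t)
    (M : ℕ → ℝ) (hM : ∀ l, 0 ≤ M l) (c7 : ℝ)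
    (ys : Fin B → Fin (n 0) → ℝ)
    (hys : ∀ i, Real.sqrt (∑ j, (ys i j) ^ 2) ≤ c7) :
    ((2 : ℝ) ^ B)⁻¹ * ∑ σ : Fin B → Bool,
      sSup {v : ℝ | ∃ W : ∀ l, Matrix (Fin (n (l + 1))) (Fin (n l)) ℝ,
        (∀ l < L, frob (W l) ≤ M l) ∧
        v = (1 / B : ℝ) * Real.sqrt (∑ k, (∑ i, (if σ i then (1:ℝ) else -1) *
              (W (L - 1)).mulVec (netHidden n sig W (L - 1) (ys i)) k) ^ 2)}
    ≤ c7 * (Real.sqrt (2 * Real.log 2 * L) + 1) * (∏ l ∈ Finset.range L, M l)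
        / Real.sqrt B := by
  have hc : 0 ≤ c7 := (Real.sqrt_nonneg _).trans (hys ⟨0, hB⟩)
  have hBr : (0:ℝ) < B := by exact_mod_cast hB
  have hP : 0 ≤ ∏ l ∈ Finset.range L, M l := Finset.prod_nonneg fun l _ => hM l
  have hsB : 0 < Real.sqrt B := Real.sqrt_pos.2 hBr
  have hsBs : Real.sqrt B * Real.sqrt B = B := Real.mul_self_sqrt hBr.le
  set R := Real.sqrt (2 * Real.log 2 * L) with hR
  set P := ∏ l ∈ Finset.range L, M l with hPdef
  rw [inv_mul_le_iff₀ (by positivity)]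
  apply sum_sSup_le
  · intro σ
    exact ⟨_, fun _ => 0, fun l _ => by simpa [frob] using hM l, rfl⟩
  intro v hv
  choose W hW hvW using hv
  set Z : (Fin B → Bool) → ℝ := fun σ => enrm (ssum σ (fun i =>
    (W σ (L - 1)).mulVec (netHidden n sig (W σ) (L - 1) (ys i)))) with hZdef
  have hvZ : ∀ σ, v σ = (1 / B : ℝ) * Z σ := fun σ => hvW σ
  obtain ⟨L', rfl⟩ : ∃ L', L = L' + 1 := ⟨L - 1, by omega⟩
  have hmean := mean_bound (L' + 1) hL Z (P * (c7 * Real.sqrt B)) (by positivity) (by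
    intro K hK
    have hb := hidden_bound (L' + 1) B n sig hsig_lip hsig_hom M hM c7 ys hys L' (by omega)
      (K * M L') (mul_nonneg hK (hM _)) (fun σ => ⟨W σ, hW σ⟩)
    refine le_trans (Finset.sum_le_sum fun σ _ => Real.exp_le_exp.2 ?_) (hb.trans (le_of_eq ?_))
    · rw [mul_assoc]
      refine mul_le_mul_of_nonneg_left ?_ hK
      have e : ssum σ (fun i => (W σ L').mulVec (netHidden n sig (W σ) L' (ys i)))
          = (W σ L').mulVec (ssum σ (fun i => netHidden n sig (W σ) L' (ys i))) := by
        funext k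
        exact dot_ssum σ (fun i => netHidden n sig (W σ) L' (ys i)) (W σ L' k)
      change enrm (ssum σ (fun i => (W σ L').mulVec (netHidden n sig (W σ) L' (ys i)))) ≤
        M L' * enrm (ssum σ (fun i => netHidden n sig (W σ) L' (ys i)))
      rw [e]
      refine (enrm_mulVec_le _ _).trans ?_
      exact mul_le_mul_of_nonneg_right (hW σ L' (by omega)) (enrm_nonneg _)
    · rw [hPdef, Finset.prod_range_succ]
      have : (c7 * Real.sqrt B) ^ 2 = B * c7 ^ 2 := by rw [mul_pow, Real.sq_sqrt hBr.le]; ring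
      rw [mul_pow _ (c7 * Real.sqrt B), this]
      have e2 : (K * M L' * ∏ l ∈ Finset.range L', M l) ^ 2 * (B * c7 ^ 2) / 2
        = K ^ 2 * (((∏ l ∈ Finset.range L', M l) * M L') ^ 2 * (B * c7 ^ 2)) / 2 := by ring
      rw [e2]; ring)
  rw [inv_mul_le_iff₀ (by positivity)] at hmean
  simp only [hvZ]
  rw [← Finset.mul_sum]
  calc (1 / B : ℝ) * ∑ σ, Z σ ≤ (1 / B : ℝ) * (2 ^ B * (P * (c7 * Real.sqrt B) * R)) :=
        mul_le_mul_of_nonneg_left hmean (by positivity)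
    _ = 2 ^ B * (c7 * R * P / Real.sqrt B) := by
        field_simp
        rw [Real.sq_sqrt hBr.le]
        ring
    _ ≤ _ := by
        have hR0 : 0 ≤ R := Real.sqrt_nonneg _
        gcongr
        linarith
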